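/- Let x be an index with 1 < x ≤ n and BWT[x] ≠ BWT[x-1], let c ∈ {BWT[x], BWT[x-1]}, and set ℓ := Candt_c(b(x), e(x)). Set ℓ* := ℓ if w(ℓ) = LCP[ℓ] and ℓ* := ℓ+1 otherwise. Then b(x) ≤ b(ℓ*) ≤ ℓ, the interval [b(ℓ*), ℓ] is contained in [b(x), e(x)), and ℓ = Candt_c(b(ℓ*), ℓ+1). -/

import Mathlib

open scoped Classical

/-- `seg T i len` is the string `T[i..i+len-1]`. -/
def seg (T : ℕ → ℤ) (i len : ℕ) : List ℤ :=
  (List.range len).map fun k => T (i + k)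

/-- `sfx T n p` is the suffix `T[p..n]` of a length-`n` text. -/
def sfx (T : ℕ → ℤ) (n p : ℕ) : List ℤ := seg T p (n + 1 - p)

/-- The reversed text: `Trev T n n = T n` and `Trev T n i = T (n - i)` for `i < n`. -/
def Trev (T : ℕ → ℤ) (n : ℕ) : ℕ → ℤ := fun i => if i = n then T n else T (n - i)

/-- Length of the longest common prefix of two strings. -/
def lcpLen : List ℤ → List ℤ → ℕ
  | a :: l₁, b :: l₂ => if a = b then lcpLen l₁ l₂ + 1 else 0
  | _, _ => 0

/-- `s` occurs as a substring of `T[1..n]`. -/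
def OccursIn (T : ℕ → ℤ) (n : ℕ) (s : List ℤ) : Prop :=
  ∃ i : ℕ, 1 ≤ i ∧ i + s.length ≤ n + 1 ∧ s = seg T i s.length

/-- `s` is a right-maximal substring of `T[1..n]` over the alphabet `{1,…,σ}`. -/
def RightMax (T : ℕ → ℤ) (n σ : ℕ) (s : List ℤ) : Prop :=
  ∃ a b : ℤ, a ≠ b ∧ 1 ≤ a ∧ a ≤ (σ : ℤ) ∧ 1 ≤ b ∧ b ≤ (σ : ℤ) ∧
    OccursIn T n (s ++ [a]) ∧ OccursIn T n (s ++ [b])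

/-- `X` is a suffixient set for `T[1..n]`. -/
def Suffixient (T : ℕ → ℤ) (n σ : ℕ) (X : Set ℕ) : Prop :=
  ∀ s : List ℤ, RightMax T n σ s → ∀ c : ℤ, 1 ≤ c → c ≤ (σ : ℤ) →
    OccursIn T n (s ++ [c]) → ∃ x ∈ X, (s ++ [c]) <:+ seg T 1 x

def StartRun (BWT : ℕ → ℤ) (x : ℕ) : Prop := 1 < x ∧ BWT x ≠ BWT (x - 1)

def EndRun (BWT : ℕ → ℤ) (n x : ℕ) : Prop := x < n ∧ BWT x ≠ BWT (x + 1)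

def RunBoundary (BWT : ℕ → ℤ) (n x : ℕ) : Prop := StartRun BWT x ∨ EndRun BWT n x

/-- `bIdx L x` : the largest index `y < x` with `L y < L x`, or `1` if none exists. -/
noncomputable def bIdx (L : ℕ → ℤ) (x : ℕ) : ℕ :=
  sSup {y : ℕ | (1 ≤ y ∧ y < x ∧ L y < L x) ∨ y = 1}

/-- `eIdx L n x` : the smallest index `y > x` with `L y < L x`, or `n+1` if none exists. -/
noncomputable def eIdx (L : ℕ → ℤ) (n x : ℕ) : ℕ :=
  sInf {y : ℕ | (x < y ∧ y ≤ n ∧ L y < L x) ∨ y = n + 1}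

/-- The maximal weight `w y` over indices `a ≤ y < a'` with `BWT y = c` and `w y ≥ 0`. -/
noncomputable def wMax (BWT w : ℕ → ℤ) (c : ℤ) (a a' : ℕ) : ℤ :=
  (sSup {m : ℕ | ∃ q : ℕ, a ≤ q ∧ q < a' ∧ BWT q = c ∧ 0 ≤ w q ∧ (m : ℤ) = w q} : ℕ)

/-- `Candt BWT w c a a'`: the smallest index `a ≤ p < a'` with `BWT p = c` whose weight
attains the maximum weight among such indices; `-1` if no index
`a ≤ y < a'` with `BWT y = c` and `w y ≥ 0` exists. -/
noncomputable def Candt (BWT w : ℕ → ℤ) (c : ℤ) (a a' : ℕ) : ℤ :=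
  if ∃ p : ℕ, a ≤ p ∧ p < a' ∧ BWT p = c ∧ 0 ≤ w p then
    ((sInf {p : ℕ | a ≤ p ∧ p < a' ∧ BWT p = c ∧ w p = wMax BWT w c a a'} : ℕ) : ℤ)
  else -1

def FullL (n : ℕ) (SA : ℕ → ℕ) (BWT LCP w : ℕ → ℤ) : Set ℕ :=
  { q | ∃ x : ℕ, 1 < x ∧ x ≤ n ∧ BWT x ≠ BWT (x - 1) ∧
      ∃ c : ℤ, (c = BWT x ∨ c = BWT (x - 1)) ∧
      ∃ p : ℕ, (p : ℤ) = Candt BWT w c (bIdx LCP x) (eIdx LCP n x) ∧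
        q = n - SA p + 1 }

/-- Basic assumptions on the text `T[1..n]` over alphabet `{1,…,σ}` with sentinel `dollar`. -/
structure TextSetup (n σ : ℕ) (T : ℕ → ℤ) (dollar : ℤ) : Prop where
  hn : 2 ≤ n
  hsigma : 2 ≤ σ
  hsigma_le : σ ≤ n
  hT : ∀ i, 1 ≤ i → i ≤ n → 1 ≤ T i ∧ T i ≤ (σ : ℤ)
  hTn : T n = dollar
  hTne : ∀ i, 1 ≤ i → i < n → T i ≠ dollar

/-- `SA[1..n]` is the suffix array of the reversed text. -/
structure SASetup (n σ : ℕ) (T : ℕ → ℤ) (dollar : ℤ) (SA : ℕ → ℕ)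
    extends TextSetup n σ T dollar : Prop where
  hSAmem : ∀ i, 1 ≤ i → i ≤ n → 1 ≤ SA i ∧ SA i ≤ n
  hSAinj : ∀ i j, 1 ≤ i → i ≤ n → 1 ≤ j → j ≤ n → SA i = SA j → i = j
  hSAsurj : ∀ p, 1 ≤ p → p ≤ n → ∃ i, 1 ≤ i ∧ i ≤ n ∧ SA i = p
  hSAord : ∀ i j, 1 ≤ i → i < j → j ≤ n →
    List.Lex (· < ·) (sfx (Trev T n) n (SA i)) (sfx (Trev T n) n (SA j))

/-- `LCP[1..n]` is the LCP array of the reversed text. -/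
structure LCPSetup (n σ : ℕ) (T : ℕ → ℤ) (dollar : ℤ) (SA : ℕ → ℕ) (LCP : ℕ → ℤ)
    extends SASetup n σ T dollar SA : Prop where
  hLCP1 : LCP 1 = -1
  hLCP : ∀ i, 1 < i → i ≤ n →
    LCP i = (lcpLen (sfx (Trev T n) n (SA (i - 1))) (sfx (Trev T n) n (SA i)) : ℤ)
  hLCPend : LCP (n + 1) = -1

/-- Additionally, `BWT[1..n]` is the BWT of the reversed text and `w` is the weight function. -/
structure FullSetup (n σ : ℕ) (T : ℕ → ℤ) (dollar : ℤ) (SA : ℕ → ℕ)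
    (BWT LCP w : ℕ → ℤ) extends LCPSetup n σ T dollar SA LCP : Prop where
  hBWT : ∀ i, 1 ≤ i → i ≤ n → BWT i = T (n - SA i + 1)
  hBWTend : BWT (n + 1) = -1
  hwNot : ∀ x, 1 ≤ x → x ≤ n → ¬ RunBoundary BWT n x → w x = -1
  hwRB : ∀ x, 1 ≤ x → x ≤ n → RunBoundary BWT n x →
    (∃ s : List ℤ, RightMax T n σ s ∧ s <:+ seg T 1 (n - SA x)) →
    IsGreatest {m : ℤ | ∃ s : List ℤ, RightMax T n σ s ∧ s <:+ seg T 1 (n - SA x) ∧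
      m = (s.length : ℤ)} (w x)

/-- `sIdx`: the minimum index `i ∈ [1..n]` such that `T[n-SA[ℓ]+1-w(ℓ)..n-SA[ℓ]]`
is a suffix of `T[1..n-SA[i]]`. -/
noncomputable def sIdx (T : ℕ → ℤ) (n : ℕ) (SA : ℕ → ℕ) (w : ℕ → ℤ) (l : ℕ) : ℕ :=
  sInf {i : ℕ | 1 ≤ i ∧ i ≤ n ∧
    seg T (n - SA l + 1 - (w l).toNat) (w l).toNat <:+ seg T 1 (n - SA i)}

/-- `tIdx`: the maximum such index. -/
noncomputable def tIdx (T : ℕ → ℤ) (n : ℕ) (SA : ℕ → ℕ) (w : ℕ → ℤ) (l : ℕ) : ℕ :=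
  sSup {i : ℕ | 1 ≤ i ∧ i ≤ n ∧
    seg T (n - SA l + 1 - (w l).toNat) (w l).toNat <:+ seg T 1 (n - SA i)}

/-- `pIdx c i`: the largest index `j < i` with `w j > -1` and `BWT j = c`, or `0`. -/
noncomputable def pIdx (BWT w : ℕ → ℤ) (c : ℤ) (i : ℕ) : ℕ :=
  sSup {j : ℕ | (1 ≤ j ∧ j < i ∧ -1 < w j ∧ BWT j = c) ∨ j = 0}

/-- `pW c i`: the weight of `pIdx c i`, or `-1` if no index as in `pIdx` exists. -/
noncomputable def pW (BWT w : ℕ → ℤ) (c : ℤ) (i : ℕ) : ℤ :=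
  if ∃ j : ℕ, 1 ≤ j ∧ j < i ∧ -1 < w j ∧ BWT j = c then w (pIdx BWT w c i) else -1

/-- `α` is colexicographically smaller than `β`. -/
def ColexLt (α β : List ℤ) : Prop :=
  (α ≠ β ∧ α <:+ β) ∨
  ∃ k : ℕ, 1 ≤ k ∧ k ≤ α.length ∧ k ≤ β.length ∧
    (∀ i, 1 ≤ i → i < k → α.getD (α.length - i) 0 = β.getD (β.length - i) 0) ∧
    α.getD (α.length - k) 0 < β.getD (β.length - k) 0

@[simp]
theorem length_seg (T : ℕ → ℤ) (i len : ℕ) : (seg T i len).length = len := by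
  simp [seg]

theorem seg_add (T : ℕ → ℤ) (i a b : ℕ) : seg T i (a + b) = seg T i a ++ seg T (i + a) b := by
  simp [seg, List.range_add, add_assoc]

theorem seg_one (T : ℕ → ℤ) (i : ℕ) : seg T i 1 = [T i] := by
  simp [seg]

theorem mem_seg {T : ℕ → ℤ} {i len : ℕ} {a : ℤ} (h : a ∈ seg T i len) :
    ∃ k < len, T (i + k) = a := by
  simpa [seg] using h

theorem suffix_seg_iff {T : ℕ → ℤ} {p : ℕ} {s : List ℤ} :
    s <:+ seg T 1 p ↔ s.length ≤ p ∧ s = seg T (1 + (p - s.length)) s.length := by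
  constructor
  · intro h
    have hle : s.length ≤ p := by simpa using h.length_le
    refine ⟨hle, ?_⟩
    obtain ⟨t, ht⟩ := h
    have hsplit := seg_add T 1 (p - s.length) s.length
    rw [Nat.sub_add_cancel hle, ← ht] at hsplit
    exact (List.append_inj' hsplit (by simp)).2
  · rintro ⟨hle, hs⟩
    have hsplit := seg_add T 1 (p - s.length) s.length
    rw [Nat.sub_add_cancel hle, ← hs] at hsplit
    exact ⟨_, hsplit.symm⟩

theorem sfx_Trev (T : ℕ → ℤ) {n p : ℕ} (hpn : p ≤ n) :
    sfx (Trev T n) n p = (seg T 1 (n - p)).reverse ++ [T n] := by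
  have hlen : n + 1 - p = (n - p) + 1 := by omega
  rw [sfx, hlen, seg_add, seg_one]
  congr 1
  · apply List.ext_getElem
    · simp
    · intro k hk _
      simp only [length_seg] at hk
      simp only [seg, List.getElem_map, List.getElem_range, List.getElem_reverse, List.length_map,
        List.length_range, Trev]
      rw [if_neg (by omega)]
      congr 1
      omega
  · simp [Trev, Nat.add_sub_cancel' hpn]

/-- A common prefix of the two ends of a lexicographic chain is a prefix of its middle element. -/
theorem prefix_of_lex_of_lex {u a b c : List ℤ} (ha : u <+: a) (hc : u <+: c)
    (hab : List.Lex (· < ·) a b) (hbc : List.Lex (· < ·) b c) : u <+: b := by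
  induction u generalizing a b c with
  | nil => exact List.nil_prefix
  | cons h u ih =>
    obtain ⟨a', rfl⟩ := ha
    obtain ⟨c', rfl⟩ := hc
    simp only [List.cons_append] at hab hbc
    cases hab with
    | cons hab =>
      cases hbc with
      | cons hbc =>
        exact (List.prefix_cons_inj h).2 (ih ⟨a', rfl⟩ ⟨c', rfl⟩ hab hbc)
      | rel hlt => exact absurd hlt (lt_irrefl _)
    | rel hlt =>
      cases hbc with
      | cons hbc => exact absurd hlt (lt_irrefl _)
      | rel hlt' => exact absurd hlt (lt_asymm hlt')

theorem length_le_lcpLen {u a b : List ℤ} (ha : u <+: a) (hb : u <+: b) :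
    u.length ≤ lcpLen a b := by
  induction u generalizing a b with
  | nil => simp
  | cons h u ih =>
    obtain ⟨a', rfl⟩ := ha
    obtain ⟨b', rfl⟩ := hb
    simpa [lcpLen] using ih ⟨a', rfl⟩ ⟨b', rfl⟩

theorem exists_prefix_length_eq_lcpLen {d : ℤ} {a b : List ℤ} (hne : a ≠ b) (ha : d ∉ a)
    (hb : d ∉ b) :
    ∃ u, u <+: a ∧ u <+: b ∧ u.length = lcpLen (a ++ [d]) (b ++ [d]) := by
  induction a generalizing b with
  | nil =>
    cases b with
    | nil => exact absurd rfl hne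
    | cons y b =>
      have hdy : d ≠ y := fun h => hb (by simp [h])
      exact ⟨[], by simp, by simp, by simp [lcpLen, hdy]⟩
  | cons x a ih =>
    cases b with
    | nil =>
      have hxd : x ≠ d := fun h => ha (by simp [h])
      exact ⟨[], by simp, by simp, by simp [lcpLen, hxd]⟩
    | cons y b =>
      by_cases hxy : x = y
      · subst hxy
        obtain ⟨u, hua, hub, hu⟩ := ih (b := b) (fun h => hne (by rw [h]))
          (fun h => ha (List.mem_cons_of_mem _ h)) (fun h => hb (List.mem_cons_of_mem _ h))
        exact ⟨x :: u, (List.prefix_cons_inj x).2 hua, (List.prefix_cons_inj x).2 hub,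
          by simp [lcpLen, hu]⟩
      · exact ⟨[], by simp, by simp, by simp [lcpLen, hxy]⟩

theorem occursIn_append_iff {T : ℕ → ℤ} {n : ℕ} {s : List ℤ} {a : ℤ} :
    OccursIn T n (s ++ [a]) ↔ ∃ p < n, s <:+ seg T 1 p ∧ T (p + 1) = a := by
  constructor
  · rintro ⟨i, hi, hin, hs⟩
    simp only [List.length_append, List.length_singleton] at hin hs
    rw [seg_add, seg_one] at hs
    obtain ⟨hs, ha⟩ := List.append_inj' hs rfl
    refine ⟨i + s.length - 1, by omega, suffix_seg_iff.2 ⟨by omega, ?_⟩, ?_⟩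
    · rwa [show 1 + (i + s.length - 1 - s.length) = i by omega]
    · rw [show i + s.length - 1 + 1 = i + s.length by omega]
      exact (List.singleton_inj.1 ha).symm
  · rintro ⟨p, hpn, hs, rfl⟩
    obtain ⟨hle, hs⟩ := suffix_seg_iff.1 hs
    refine ⟨1 + (p - s.length), by omega, ?_, ?_⟩
    · simp only [List.length_append, List.length_singleton]
      omega
    · simp only [List.length_append, List.length_singleton]
      rw [seg_add, seg_one, ← hs, show 1 + (p - s.length) + s.length = p + 1 by omega]

theorem bIdx_mem (L : ℕ → ℤ) (x : ℕ) :
    (1 ≤ bIdx L x ∧ bIdx L x < x ∧ L (bIdx L x) < L x) ∨ bIdx L x = 1 :=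
  Nat.sSup_mem (s := {y : ℕ | (1 ≤ y ∧ y < x ∧ L y < L x) ∨ y = 1}) ⟨1, Or.inr rfl⟩
    ⟨x + 1, by rintro y (⟨_, h, _⟩ | rfl) <;> omega⟩

theorem le_bIdx {L : ℕ → ℤ} {x y : ℕ} (hy : 1 ≤ y) (hyx : y < x) (hL : L y < L x) :
    y ≤ bIdx L x :=
  le_csSup (s := {y : ℕ | (1 ≤ y ∧ y < x ∧ L y < L x) ∨ y = 1})
    ⟨x + 1, by rintro y (⟨_, h, _⟩ | rfl) <;> omega⟩ (Or.inl ⟨hy, hyx, hL⟩)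

theorem eIdx_mem (L : ℕ → ℤ) (n x : ℕ) :
    (x < eIdx L n x ∧ eIdx L n x ≤ n ∧ L (eIdx L n x) < L x) ∨ eIdx L n x = n + 1 :=
  Nat.sInf_mem (s := {y : ℕ | (x < y ∧ y ≤ n ∧ L y < L x) ∨ y = n + 1}) ⟨n + 1, Or.inr rfl⟩

theorem le_of_lt_eIdx {L : ℕ → ℤ} {n x y : ℕ} (hxy : x < y) (hyn : y ≤ n)
    (hy : y < eIdx L n x) : L x ≤ L y := by
  by_contra! hlt
  exact Nat.notMem_of_lt_sInf hy (Or.inl ⟨hxy, hyn, hlt⟩)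

theorem bddAbove_weights (BWT w : ℕ → ℤ) (c : ℤ) (a a' : ℕ) : BddAbove
    {m : ℕ | ∃ q : ℕ, a ≤ q ∧ q < a' ∧ BWT q = c ∧ 0 ≤ w q ∧ (m : ℤ) = w q} := by
  refine (((Set.finite_Iio a').image fun q => (w q).toNat).subset ?_).bddAbove
  rintro m ⟨q, -, hq, -, -, hm⟩
  exact ⟨q, hq, by simp [← hm]⟩

theorem le_wMax {BWT w : ℕ → ℤ} {c : ℤ} {a a' q : ℕ} (ha : a ≤ q) (ha' : q < a')
    (hc : BWT q = c) (hq : 0 ≤ w q) : w q ≤ wMax BWT w c a a' := by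
  rw [wMax, ← Int.toNat_of_nonneg hq]
  exact Int.ofNat_le.2 (le_csSup (bddAbove_weights BWT w c a a')
    ⟨q, ha, ha', hc, hq, Int.toNat_of_nonneg hq⟩)

theorem exists_eq_wMax {BWT w : ℕ → ℤ} {c : ℤ} {a a' : ℕ}
    (h : ∃ p : ℕ, a ≤ p ∧ p < a' ∧ BWT p = c ∧ 0 ≤ w p) :
    ∃ p : ℕ, a ≤ p ∧ p < a' ∧ BWT p = c ∧ 0 ≤ w p ∧ wMax BWT w c a a' = w p := by
  obtain ⟨p, hap, hpa', hpc, hwp⟩ := h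
  exact Nat.sSup_mem (s := {m : ℕ | ∃ q : ℕ, a ≤ q ∧ q < a' ∧ BWT q = c ∧ 0 ≤ w q ∧ (m : ℤ) = w q})
    ⟨(w p).toNat, p, hap, hpa', hpc, hwp, Int.toNat_of_nonneg hwp⟩
    (bddAbove_weights BWT w c a a')

theorem natCast_eq_Candt_iff {BWT w : ℕ → ℤ} {c : ℤ} {a a' l : ℕ} :
    (l : ℤ) = Candt BWT w c a a' ↔ a ≤ l ∧ l < a' ∧ BWT l = c ∧ 0 ≤ w l ∧
      ∀ q, a ≤ q → q < a' → BWT q = c → w q ≤ w l ∧ (w q = w l → l ≤ q) := by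
  constructor
  · intro hl
    rw [Candt] at hl
    split_ifs at hl with h
    · have hinf := Int.ofNat_inj.1 hl
      obtain ⟨p, hap, hpa', hpc, hwp, hp⟩ := exists_eq_wMax h
      have hmem := Nat.sInf_mem
        (s := {p : ℕ | a ≤ p ∧ p < a' ∧ BWT p = c ∧ w p = wMax BWT w c a a'})
        ⟨p, hap, hpa', hpc, hp.symm⟩
      rw [← hinf] at hmem
      obtain ⟨hal, hla', hlc, hwl⟩ := hmem
      refine ⟨hal, hla', hlc, by omega, fun q haq hqa' hqc => ⟨?_, fun hq => ?_⟩⟩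
      · rcases lt_or_ge (w q) 0 with hneg | hpos
        · omega
        · exact hwl ▸ le_wMax haq hqa' hqc hpos
      · rw [hinf]
        exact Nat.sInf_le ⟨haq, hqa', hqc, hq.trans hwl⟩
  · rintro ⟨hal, hla', hlc, hwl, hmax⟩
    have h : ∃ p : ℕ, a ≤ p ∧ p < a' ∧ BWT p = c ∧ 0 ≤ w p := ⟨l, hal, hla', hlc, hwl⟩
    obtain ⟨p, hap, hpa', hpc, -, hp⟩ := exists_eq_wMax h
    have hlW : w l = wMax BWT w c a a' :=
      le_antisymm (le_wMax hal hla' hlc hwl) (hp ▸ (hmax p hap hpa' hpc).1)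
    rw [Candt, if_pos h]
    refine congrArg _ (le_antisymm (le_csInf ⟨l, hal, hla', hlc, hlW⟩ ?_)
      (Nat.sInf_le ⟨hal, hla', hlc, hlW⟩))
    rintro q ⟨haq, hqa', hqc, hq⟩
    exact (hmax q haq hqa' hqc).2 (hq.trans hlW.symm)

/-- Restricting the range of a candidate to a subrange containing it keeps it a candidate. -/
theorem natCast_eq_Candt_of_subset {BWT w : ℕ → ℤ} {c : ℤ} {a a' d d' l : ℕ}
    (hl : (l : ℤ) = Candt BWT w c a a') (had : a ≤ d) (hdl : d ≤ l) (hld : l < d')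
    (hda : d' ≤ a') : (l : ℤ) = Candt BWT w c d d' := by
  rw [natCast_eq_Candt_iff] at hl ⊢
  obtain ⟨-, -, hlc, hwl, hmax⟩ := hl
  exact ⟨hdl, hld, hlc, hwl, fun q hdq hqd => hmax q (had.trans hdq) (hqd.trans_le hda)⟩

/-- A nonconstant sequence on `[y, l]` changes its value for the last time at some `z ∈ (y, l]`. -/
theorem exists_last_change {f : ℕ → ℤ} {c : ℤ} {y l : ℕ} (hyl : y < l) (hy : f y ≠ c)
    (hl : f l = c) : ∃ z, y < z ∧ z ≤ l ∧ f z = c ∧ f (z - 1) ≠ c := by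
  have hex : ∃ z, y < z ∧ f z = c := ⟨l, hyl, hl⟩
  obtain ⟨hz, hzc⟩ := Nat.find_spec hex
  refine ⟨Nat.find hex, hz, Nat.find_min' hex ⟨hyl, hl⟩, hzc, fun h => ?_⟩
  rcases Nat.lt_or_ge y (Nat.find hex - 1) with hlt | hge
  · exact Nat.find_min hex (by omega) ⟨hlt, h⟩
  · exact hy (by rwa [show Nat.find hex - 1 = y by omega] at h)

section FullSetup

variable {n σ : ℕ} {T : ℕ → ℤ} {dollar : ℤ} {SA : ℕ → ℕ} {BWT LCP w : ℕ → ℤ}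

theorem FullSetup.LCP_nonneg (h : FullSetup n σ T dollar SA BWT LCP w) {z : ℕ} (hz1 : 1 < z)
    (hzn : z ≤ n) : 0 ≤ LCP z := by
  rw [h.hLCP z hz1 hzn]
  exact Int.natCast_nonneg _

theorem FullSetup.isGreatest_w (h : FullSetup n σ T dollar SA BWT LCP w) {z : ℕ} (hz1 : 1 ≤ z)
    (hzn : z ≤ n) (hz : RunBoundary BWT n z) :
    IsGreatest {m : ℤ | ∃ s : List ℤ, RightMax T n σ s ∧ s <:+ seg T 1 (n - SA z) ∧
      m = (s.length : ℤ)} (w z) := by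
  have hn := h.hn
  refine h.hwRB z hz1 hzn hz ⟨[], ⟨T 1, T n, ?_, (h.hT 1 le_rfl (by omega)).1,
    (h.hT 1 le_rfl (by omega)).2, (h.hT n (by omega) le_rfl).1, (h.hT n (by omega) le_rfl).2,
    occursIn_append_iff.2 ⟨0, by omega, List.nil_suffix, rfl⟩,
    occursIn_append_iff.2 ⟨n - 1, by omega, List.nil_suffix, ?_⟩⟩, List.nil_suffix⟩
  · rw [h.hTn]
    exact h.hTne 1 le_rfl (by omega)
  · rw [Nat.sub_add_cancel (by omega)]

/-- The two positions adjacent to a run break at `z` share the right-maximal string of length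
`LCP z`. -/
theorem FullSetup.exists_rightMax (h : FullSetup n σ T dollar SA BWT LCP w) {z : ℕ}
    (hz1 : 1 < z) (hzn : z ≤ n) (hz : BWT z ≠ BWT (z - 1)) :
    ∃ s : List ℤ, RightMax T n σ s ∧ s <:+ seg T 1 (n - SA (z - 1)) ∧
      s <:+ seg T 1 (n - SA z) ∧ LCP z = s.length := by
  obtain ⟨hp1, hpn⟩ := h.hSAmem (z - 1) (by omega) (by omega)
  obtain ⟨hq1, hqn⟩ := h.hSAmem z (by omega) hzn
  have hd : ∀ p, 1 ≤ p → T n ∉ (seg T 1 (n - p)).reverse := by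
    intro p hp hmem
    obtain ⟨k, hk, hkT⟩ := mem_seg (List.mem_reverse.1 hmem)
    exact h.hTne (1 + k) (by omega) (by omega) (hkT.trans h.hTn)
  have hne : (seg T 1 (n - SA (z - 1))).reverse ≠ (seg T 1 (n - SA z)).reverse := by
    intro heq
    have hlen := congrArg List.length heq
    simp only [List.length_reverse, length_seg] at hlen
    have := h.hSAinj (z - 1) z (by omega) (by omega) (by omega) hzn (by omega)
    omega
  obtain ⟨u, hu, hu', hlen⟩ := exists_prefix_length_eq_lcpLen hne (hd _ hp1) (hd _ hq1)
  rw [← sfx_Trev T hpn, ← sfx_Trev T hqn] at hlen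
  rw [← u.reverse_reverse, List.reverse_prefix] at hu hu'
  have hB := h.hBWT z (by omega) hzn
  have hB' := h.hBWT (z - 1) (by omega) (by omega)
  have hT := h.hT (n - SA z + 1) (by omega) (by omega)
  have hT' := h.hT (n - SA (z - 1) + 1) (by omega) (by omega)
  refine ⟨u.reverse, ⟨_, _, hz, hB ▸ hT.1, hB ▸ hT.2, hB' ▸ hT'.1, hB' ▸ hT'.2,
    occursIn_append_iff.2 ⟨n - SA z, by omega, hu', hB.symm⟩,
    occursIn_append_iff.2 ⟨n - SA (z - 1), by omega, hu, hB'.symm⟩⟩, hu, hu', ?_⟩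
  rw [h.hLCP z hz1 hzn, List.length_reverse, hlen]

theorem FullSetup.LCP_le_w (h : FullSetup n σ T dollar SA BWT LCP w) {z : ℕ}
    (hz1 : 1 < z) (hzn : z ≤ n) (hz : BWT z ≠ BWT (z - 1)) : LCP z ≤ w z := by
  obtain ⟨s, hs, -, hsz, hlen⟩ := h.exists_rightMax hz1 hzn hz
  exact (h.isGreatest_w (by omega) hzn (Or.inl ⟨hz1, hz⟩)).2 ⟨s, hs, hsz, hlen⟩

theorem FullSetup.LCP_le_w_pred (h : FullSetup n σ T dollar SA BWT LCP w) {z : ℕ}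
    (hz1 : 1 < z) (hzn : z ≤ n) (hz : BWT z ≠ BWT (z - 1)) : LCP z ≤ w (z - 1) := by
  obtain ⟨s, hs, hsz, -, hlen⟩ := h.exists_rightMax hz1 hzn hz
  refine (h.isGreatest_w (by omega) (by omega) (Or.inr ⟨by omega, ?_⟩)).2 ⟨s, hs, hsz, hlen⟩
  rw [Nat.sub_add_cancel (by omega)]
  exact hz.symm

theorem FullSetup.prefix_of_suffix (h : FullSetup n σ T dollar SA BWT LCP w) {i : ℕ}
    (hi1 : 1 ≤ i) (hin : i ≤ n) {s : List ℤ} (hs : s <:+ seg T 1 (n - SA i)) :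
    s.reverse <+: sfx (Trev T n) n (SA i) := by
  rw [sfx_Trev T (h.hSAmem i hi1 hin).2]
  exact (List.reverse_prefix.2 hs).trans (List.prefix_append _ _)

/-- The `LCP` values between two suffixes sharing a prefix are at least its length. -/
theorem FullSetup.length_le_LCP (h : FullSetup n σ T dollar SA BWT LCP w) {i j z : ℕ}
    (hi1 : 1 ≤ i) (hjn : j ≤ n) {s : List ℤ} (hsi : s <:+ seg T 1 (n - SA i))
    (hsj : s <:+ seg T 1 (n - SA j)) (hiz : i < z) (hzj : z ≤ j) : (s.length : ℤ) ≤ LCP z := by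
  have hbetween : ∀ k, i ≤ k → k ≤ j → s.reverse <+: sfx (Trev T n) n (SA k) := by
    intro k hik hkj
    have hpi := h.prefix_of_suffix hi1 (by omega) hsi
    have hpj := h.prefix_of_suffix (by omega) hjn hsj
    rcases hik.eq_or_lt with rfl | hik
    · exact hpi
    rcases hkj.eq_or_lt with rfl | hkj
    · exact hpj
    exact prefix_of_lex_of_lex hpi hpj (h.hSAord i k hi1 hik (by omega))
      (h.hSAord k j (by omega) hkj hjn)
  rw [h.hLCP z (by omega) (by omega), ← s.length_reverse]
  exact_mod_cast length_le_lcpLen (hbetween (z - 1) (by omega) (by omega))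
    (hbetween z (by omega) hzj)

/-- The right-maximal string realizing a weight also occurs before a different character. -/
theorem FullSetup.exists_ne_of_w_nonneg (h : FullSetup n σ T dollar SA BWT LCP w) {l : ℕ}
    (hl1 : 1 ≤ l) (hln : l ≤ n) (hw : 0 ≤ w l) :
    ∃ s : List ℤ, ∃ y, 1 ≤ y ∧ y ≤ n ∧ BWT y ≠ BWT l ∧ s <:+ seg T 1 (n - SA l) ∧
      s <:+ seg T 1 (n - SA y) ∧ w l = s.length := by
  have hrb : RunBoundary BWT n l := by
    by_contra hnot
    have := h.hwNot l hl1 hln hnot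
    omega
  obtain ⟨s, hs, hsl, hlen⟩ := (h.isGreatest_w hl1 hln hrb).1
  have hocc : ∃ d, d ≠ BWT l ∧ OccursIn T n (s ++ [d]) := by
    obtain ⟨a, b, hab, -, -, -, -, ha, hb⟩ := hs
    rcases eq_or_ne a (BWT l) with rfl | hne
    · exact ⟨b, hab.symm, hb⟩
    · exact ⟨a, hne, ha⟩
  obtain ⟨d, hd, hocc⟩ := hocc
  obtain ⟨p, hpn, hsp, rfl⟩ := occursIn_append_iff.1 hocc
  obtain ⟨y, hy1, hyn, hy⟩ := h.hSAsurj (n - p) (by omega) (by omega)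
  have hyp : n - SA y = p := by omega
  exact ⟨s, y, hy1, hyn, by rwa [h.hBWT y hy1 hyn, hyp], hsl, hyp ▸ hsp, hlen⟩

end FullSetup

/-- Let `x` with `1 < x ≤ n` and `BWT[x] ≠ BWT[x-1]`, `c ∈ {BWT[x], BWT[x-1]}`,
`ℓ := Candt_c(b(x), e(x))`, and `ℓ* := ℓ` if `w(ℓ) = LCP[ℓ]`, `ℓ* := ℓ+1` otherwise. Then
`b(x) ≤ b(ℓ*) ≤ ℓ`, the interval `[b(ℓ*), ℓ]` is contained in `[b(x), e(x))`, and
`ℓ = Candt_c(b(ℓ*), ℓ+1)`. -/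
theorem stmt10 (n σ : ℕ) (T : ℕ → ℤ) (dollar : ℤ) (SA : ℕ → ℕ) (BWT LCP w : ℕ → ℤ)
    (hsetup : FullSetup n σ T dollar SA BWT LCP w)
    (x : ℕ) (hx1 : 1 < x) (hxn : x ≤ n) (hrun : BWT x ≠ BWT (x - 1))
    (c : ℤ) (hc : c = BWT x ∨ c = BWT (x - 1))
    (l : ℕ) (hl : (l : ℤ) = Candt BWT w c (bIdx LCP x) (eIdx LCP n x))
    (lstar : ℕ) (hlstar : lstar = if w l = LCP l then l else l + 1) :
    bIdx LCP x ≤ bIdx LCP lstar ∧ bIdx LCP lstar ≤ l ∧ l < eIdx LCP n x ∧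
      (l : ℤ) = Candt BWT w c (bIdx LCP lstar) (l + 1) := by
  have hm := hsetup.LCP_nonneg hx1 hxn
  have hL1 := hsetup.hLCP1
  have hLend := hsetup.hLCPend
  obtain ⟨hB1, hBx, hLB⟩ : 1 ≤ bIdx LCP x ∧ bIdx LCP x < x ∧ LCP (bIdx LCP x) < LCP x := by
    rcases bIdx_mem LCP x with h | h
    · exact h
    · rw [h]
      omega
  obtain ⟨hxE, hEn, hLE⟩ :
      x < eIdx LCP n x ∧ eIdx LCP n x ≤ n + 1 ∧ LCP (eIdx LCP n x) < LCP x := by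
    rcases eIdx_mem LCP n x with h | h
    · omega
    · rw [h]
      omega
  obtain ⟨hBl, hlE, hlc, hwl, hmax⟩ := natCast_eq_Candt_iff.1 hl
  have hmw : LCP x ≤ w l := by
    rcases hc with hc | hc
    · exact (hsetup.LCP_le_w hx1 hxn hrun).trans (hmax x hBx.le hxE hc.symm).1
    · exact (hsetup.LCP_le_w_pred hx1 hxn hrun).trans
        (hmax (x - 1) (by omega) (by omega) hc.symm).1
  have hlast : l + 1 = eIdx LCP n x → w l = LCP l := by
    intro hlE'
    obtain ⟨s, y, hy1, hyn, hyc, hsl, hsy, hlen⟩ :=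
      hsetup.exists_ne_of_w_nonneg (by omega) (by omega) hwl
    rcases lt_trichotomy y l with hyl | rfl | hly
    · obtain ⟨z, hyz, hzl, hzc, hzc'⟩ := exists_last_change hyl hyc rfl
      have hzrun : BWT z ≠ BWT (z - 1) := fun h => hzc' (h ▸ hzc)
      have hWz := hsetup.length_le_LCP hy1 (by omega) hsy hsl hyz hzl
      have hzw := hsetup.LCP_le_w (by omega) (by omega) hzrun
      have hBz : bIdx LCP x ≤ z := by
        by_contra! hlt
        have := hsetup.length_le_LCP hy1 (by omega) hsy hsl (hyz.trans hlt) hBl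
        omega
      obtain ⟨hzle, hzeq⟩ := hmax z hBz (by omega) (hzc.trans hlc)
      obtain rfl : z = l := le_antisymm hzl (hzeq (by omega))
      omega
    · exact absurd rfl hyc
    · have := hsetup.length_le_LCP (by omega) hyn hsl hsy (Nat.lt_succ_self l) hly
      rw [Nat.succ_eq_add_one, hlE'] at this
      omega
  have hBs : bIdx LCP x ≤ bIdx LCP lstar ∧ bIdx LCP lstar ≤ l := by
    have hle : bIdx LCP lstar ≤ l := by
      rcases bIdx_mem LCP lstar with h | h <;> split_ifs at hlstar <;> omega
    refine ⟨?_, hle⟩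
    split_ifs at hlstar with hwL
    · have hne : bIdx LCP x ≠ l := by
        intro heq
        rw [heq] at hLB
        omega
      subst hlstar
      exact le_bIdx hB1 (by omega) (by omega)
    · have hlt : l + 1 < eIdx LCP n x := lt_of_le_of_ne hlE fun h => hwL (hlast h)
      have hLl : LCP x ≤ LCP (l + 1) ∨ l + 1 < x := by
        rcases lt_trichotomy (l + 1) x with h | h | h
        · exact Or.inr h
        · exact Or.inl (by rw [h])
        · exact Or.inl (le_of_lt_eIdx h (by omega) hlt)
      subst hlstar
      refine le_bIdx hB1 (by omega) (hLB.trans_le ?_)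
      rcases hLl with h | h
      · exact h
      · by_contra! hlt'
        have := le_bIdx (by omega) h hlt'
        omega
  exact ⟨hBs.1, hBs.2, hlE, natCast_eq_Candt_of_subset hl hBs.1 hBs.2 (Nat.lt_succ_self l) hlE⟩
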